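/- arXiv:2012.14079 — 2 statements merged into one kernel-verified Lean document; each statement's English description precedes it below -/
import Mathlib

section
/- Let S be a 2-factor of G that is not a tour, containing the path P = {(v1,v2), (v2,v3), (v3,v4)} (v1, v2, v3, v4 distinct) in a cycle C* of S, and let v0, v5 ∈ V(C*) satisfy (v0,v1), (v4,v5) ∈ C*, v0 ≠ v2 and v5 ≠ v3. Let T′ be a path cover of G with (v2,v3), (v3,v4) ∈ T′ and V1(T′) = V \ {v3}, let C** be a cycle of S distinct from C*, and let f′ ∈ C** \ T′ be an edge with endpoint q such that T′ ∪ {f′} is a path cover of G. Then there exist four path covers S′1, S′2, T′1, T′2 of G such that: (a) S′_i ∪ T′_i = S ∪ T′ and S′_i ∩ T′_i = S ∩ T′ for i = 1,2; (b) V1(S′_i) and V1(T′_i) form a partition of V \ {v3} for i = 1,2; (c) T′1 \ T′2 = {(v1,v2)}, T′2 \ T′1 = {(v4,v5)}, and the two-edge path {(v2,v3), (v3,v4)} belongs to 𝒫(T′1 ∩ T′2); and (d) q ∈ V1(S′1) ∩ V1(S′2). -/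
variable {V : Type*} [Fintype V] [DecidableEq V]

/-- The degree of vertex `v` in the edge set `F`. -/
def degE (F : Finset (Sym2 V)) (v : V) : ℕ := (F.filter (fun e => v ∈ e)).card

/-- The set of vertices incident to an edge of `F`. -/
def VsetE (F : Finset (Sym2 V)) : Set V := {v | ∃ e ∈ F, v ∈ e}

/-- Vertices incident to exactly one edge of `F`. -/
def V1E (F : Finset (Sym2 V)) : Set V := {v | degE F v = 1}

/-- Vertices incident to exactly two edges of `F`. -/
def V2E (F : Finset (Sym2 V)) : Set V := {v | degE F v = 2}

/-- All edges are genuine edges of the complete graph (no loops). -/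
def SimpleE (F : Finset (Sym2 V)) : Prop := ∀ e ∈ F, ¬ e.IsDiag

/-- `F` is spanning: every vertex is incident to an edge of `F`. -/
def SpanningE (F : Finset (Sym2 V)) : Prop := VsetE F = Set.univ

/-- `F` is a `k`-matching: every vertex has at most `k` incident edges. -/
def IsKMatching (k : ℕ) (F : Finset (Sym2 V)) : Prop :=
  SimpleE F ∧ ∀ v : V, degE F v ≤ k

/-- `F` is a `k`-factor: every vertex has exactly `k` incident edges. -/
def IsKFactor (k : ℕ) (F : Finset (Sym2 V)) : Prop :=
  SimpleE F ∧ ∀ v : V, degE F v = k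

/-- `F` is the edge set of a single (simple) cycle. -/
def IsCycleE (F : Finset (Sym2 V)) : Prop :=
  ∃ m : ℕ, 3 ≤ m ∧ ∃ f : ℕ → V,
    (∀ i < m, ∀ j < m, f i = f j → i = j) ∧
    F = (Finset.range m).image (fun i => s(f i, f ((i + 1) % m)))

/-- `F` contains no cycle. -/
def AcyclicE (F : Finset (Sym2 V)) : Prop :=
  ∀ C : Finset (Sym2 V), C ⊆ F → ¬ IsCycleE C

/-- `F` is the edge set of a simple path with endpoints `a` and `b`. -/
def IsPathE (F : Finset (Sym2 V)) (a b : V) : Prop :=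
  ∃ m : ℕ, 1 ≤ m ∧ ∃ f : ℕ → V,
    (∀ i ≤ m, ∀ j ≤ m, f i = f j → i = j) ∧ f 0 = a ∧ f m = b ∧
    F = (Finset.range m).image (fun i => s(f i, f (i + 1)))

/-- `P` is a maximal path of `F`, i.e. `P ∈ 𝒫(F)`. -/
def MaxPathE (F P : Finset (Sym2 V)) : Prop :=
  P ⊆ F ∧ (∃ a b : V, IsPathE P a b) ∧
  ∀ e ∈ F, (∃ v : V, v ∈ e ∧ v ∈ VsetE P) → e ∈ P

/-- `F` is a path cover: a spanning acyclic 2-matching. -/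
def IsPathCoverE (F : Finset (Sym2 V)) : Prop :=
  IsKMatching 2 F ∧ SpanningE F ∧ AcyclicE F

/-- `F` is a tour: the edge set of a Hamiltonian cycle. -/
def IsTourE (F : Finset (Sym2 V)) : Prop :=
  IsCycleE F ∧ SpanningE F

/-- Total length of the edge set `F`. -/
def lenE (ℓ : Sym2 V → ℝ) (F : Finset (Sym2 V)) : ℝ := ∑ e ∈ F, ℓ e

/-- Minimum length of a tour. -/
noncomputable def optE (ℓ : Sym2 V → ℝ) : ℝ :=
  sInf {x | ∃ H : Finset (Sym2 V), IsTourE H ∧ lenE ℓ H = x}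

/-- Maximum length of a tour. -/
noncomputable def worE (ℓ : Sym2 V → ℝ) : ℝ :=
  sSup {x | ∃ H : Finset (Sym2 V), IsTourE H ∧ lenE ℓ H = x}

/-- The set of edges of `F` incident to `v`. -/
def deltaE (F : Finset (Sym2 V)) (v : V) : Finset (Sym2 V) :=
  F.filter (fun e => v ∈ e)

/-- `(S, T)` is a valid pair of spanning 2-matchings. -/
def ValidPairE (S T : Finset (Sym2 V)) : Prop :=
  IsKMatching 2 S ∧ IsKMatching 2 T ∧ SpanningE S ∧ SpanningE T ∧
  AcyclicE T ∧
  (∀ v : V, v ∈ V2E S → v ∈ V2E T → deltaE S v = deltaE T v) ∧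
  (∀ C : Finset (Sym2 V), C ⊆ S → IsCycleE C →
    ∀ P : Finset (Sym2 V), MaxPathE T P → VsetE C ≠ VsetE P)

/-- A cycle admits an `m`-periodic enumeration of its vertices. -/
lemma IsCycleE.exists_periodic {C : Finset (Sym2 V)} (h : IsCycleE C) :
    ∃ m, 3 ≤ m ∧ ∃ g : ℕ → V, (∀ i j, g i = g j ↔ i % m = j % m) ∧
      ∀ e, e ∈ C ↔ ∃ i, e = s(g i, g (i + 1)) := by
  obtain ⟨m, hm, f, hf, rfl⟩ := h
  have hlt : ∀ i, i % m < m := fun i => Nat.mod_lt _ (by omega)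
  refine ⟨m, hm, fun i => f (i % m), fun i j => ⟨fun h => hf _ (hlt i) _ (hlt j) h, fun h => ?_⟩,
    fun e => ?_⟩
  · simp only [h]
  · simp only [Finset.mem_image, Finset.mem_range]
    constructor
    · rintro ⟨i, hi, rfl⟩
      exact ⟨i, by rw [Nat.mod_eq_of_lt hi]⟩
    · rintro ⟨i, rfl⟩
      exact ⟨i % m, hlt i, by simp⟩

/-- Every vertex of a cycle has two distinct neighbours on the cycle. -/
lemma IsCycleE.exists_neighbors {C : Finset (Sym2 V)} (h : IsCycleE C) {u : V}
    (hu : u ∈ VsetE C) : ∃ x y, x ≠ y ∧ s(u, x) ∈ C ∧ s(u, y) ∈ C := by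
  obtain ⟨m, hm, g, hg, hC⟩ := h.exists_periodic
  have key : ∃ i, u = g (i + 1) := by
    obtain ⟨e, he, hue⟩ := hu
    obtain ⟨i, rfl⟩ := (hC e).1 he
    rcases Sym2.mem_iff.1 hue with rfl | rfl
    · refine ⟨i + m - 1, (hg _ _).2 ?_⟩
      rw [show i + m - 1 + 1 = i + m by omega, Nat.add_mod_right]
    · exact ⟨i, rfl⟩
  obtain ⟨i, rfl⟩ := key
  refine ⟨g i, g (i + 2), fun h => ?_, ?_, (hC _).2 ⟨i + 1, rfl⟩⟩
  · have h2 : i + 0 ≡ i + 2 [MOD m] := (hg _ _).1 h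
    have h3 : 0 % m = 2 % m := Nat.ModEq.add_left_cancel' i h2
    rw [Nat.zero_mod, Nat.mod_eq_of_lt (by omega)] at h3
    omega
  · exact (hC _).2 ⟨i, Sym2.eq_swap⟩

/-- A cycle meeting `A` is contained in `A` if `A` absorbs every edge of it that touches `A`. -/
lemma IsCycleE.subset_of_absorbs {C A : Finset (Sym2 V)} (h : IsCycleE C)
    (hA : ∀ e ∈ C, ∀ v ∈ e, v ∈ VsetE A → e ∈ A) {u : V} (hu : u ∈ VsetE C)
    (huA : u ∈ VsetE A) : C ⊆ A := by
  obtain ⟨m, hm, g, hg, hC⟩ := h.exists_periodic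
  obtain ⟨e, he, hue⟩ := hu
  obtain ⟨i₀, rfl⟩ := (hC e).1 he
  have h0 : g i₀ ∈ VsetE A := ⟨_, hA _ he _ hue huA, Sym2.mem_mk_left _ _⟩
  have hstep : ∀ k, g (i₀ + k) ∈ VsetE A := by
    intro k
    induction k with
    | zero => exact h0
    | succ k ih =>
      exact ⟨_, hA _ ((hC _).2 ⟨i₀ + k, rfl⟩) _ (Sym2.mem_mk_left _ _) ih, Sym2.mem_mk_right _ _⟩
  intro e he
  obtain ⟨i, rfl⟩ := (hC e).1 he
  refine hA _ he _ (Sym2.mem_mk_left _ _) ?_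
  have h1 : g i = g (i₀ + (i + m * i₀ - i₀)) := by
    have : i₀ ≤ m * i₀ := Nat.le_mul_of_pos_left _ (by omega)
    rw [hg, show i₀ + (i + m * i₀ - i₀) = i + m * i₀ by omega, Nat.add_mul_mod_self_left]
  rw [h1]
  exact hstep _

lemma IsCycleE.nonempty {C : Finset (Sym2 V)} (h : IsCycleE C) : C.Nonempty := by
  obtain ⟨m, hm, g, hg, hC⟩ := h.exists_periodic
  exact ⟨_, (hC _).2 ⟨0, rfl⟩⟩

/-- If `u` has degree at most two, two distinct edges at `u` are all the edges at `u`. -/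
lemma eq_or_eq_of_degE_le_two {F : Finset (Sym2 V)} {u x y : V} (hF : degE F u ≤ 2) (hxy : x ≠ y)
    (hx : s(u, x) ∈ F) (hy : s(u, y) ∈ F) {e : Sym2 V} (he : e ∈ F) (hu : u ∈ e) :
    e = s(u, x) ∨ e = s(u, y) := by
  by_contra! hne
  have hsub : ({e, s(u, x), s(u, y)} : Finset (Sym2 V)) ⊆ F.filter (fun e => u ∈ e) := by
    intro z hz
    simp only [Finset.mem_insert, Finset.mem_singleton] at hz
    rcases hz with rfl | rfl | rfl <;> simp_all
  have hcard : ({e, s(u, x), s(u, y)} : Finset (Sym2 V)).card = 3 :=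
    Finset.card_eq_three.2 ⟨_, _, _, hne.1, hne.2, fun h => hxy (Sym2.congr_right.1 h), rfl⟩
  have := Finset.card_le_card hsub
  unfold degE at hF
  omega

lemma eq_of_degE_le_one {F : Finset (Sym2 V)} {u x y : V} (hF : degE F u ≤ 1)
    (hx : s(u, x) ∈ F) (hy : s(u, y) ∈ F) : x = y :=
  Sym2.congr_right.1 (Finset.card_le_one.1 hF s(u, x) (by simp [hx]) s(u, y) (by simp [hy]))

/-- In a `2`-factor, a cycle contains every edge touching it. -/
lemma IsCycleE.mem_of_isKFactor {S C : Finset (Sym2 V)} (hS : IsKFactor 2 S) (hC : IsCycleE C)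
    (hCS : C ⊆ S) {u : V} (hu : u ∈ VsetE C) {e : Sym2 V} (he : e ∈ S) (hue : u ∈ e) : e ∈ C := by
  obtain ⟨x, y, hxy, hx, hy⟩ := hC.exists_neighbors hu
  rcases eq_or_eq_of_degE_le_two (hS.2 u).le hxy (hCS hx) (hCS hy) he hue with rfl | rfl <;>
    assumption

/-- Two cycles of a `2`-factor sharing a vertex coincide. -/
lemma IsCycleE.eq_of_isKFactor {S C D : Finset (Sym2 V)} (hS : IsKFactor 2 S) (hC : IsCycleE C)
    (hCS : C ⊆ S) (hD : IsCycleE D) (hDS : D ⊆ S) {u : V} (huC : u ∈ VsetE C)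
    (huD : u ∈ VsetE D) : C = D :=
  Finset.Subset.antisymm
    (hC.subset_of_absorbs (fun _ he _ hv hvD => hD.mem_of_isKFactor hS hDS hvD (hCS he) hv) huC huD)
    (hD.subset_of_absorbs (fun _ he _ hv hvC => hC.mem_of_isKFactor hS hCS hvC (hDS he) hv) huD huC)

/-- `u` and `x` are the ends of a nontrivial path all of whose edges lie in `F`. -/
def PathJoinedE (F : Finset (Sym2 V)) (u x : V) : Prop :=
  ∃ m : ℕ, 1 ≤ m ∧ ∃ f : ℕ → V, (∀ i ≤ m, ∀ j ≤ m, f i = f j → i = j) ∧ f 0 = u ∧ f m = x ∧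
    ∀ i < m, s(f i, f (i + 1)) ∈ F

lemma PathJoinedE.symm {F : Finset (Sym2 V)} {u x : V} (h : PathJoinedE F u x) :
    PathJoinedE F x u := by
  obtain ⟨m, hm, f, hf, h0, h1, hF⟩ := h
  refine ⟨m, hm, fun i => f (m - i), fun i hi j hj h => ?_, by simpa, by simpa, fun i hi => ?_⟩
  · have := hf _ (by omega) _ (by omega) h
    omega
  · have := hF (m - (i + 1)) (by omega)
    rw [show m - (i + 1) + 1 = m - i by omega] at this
    rwa [Sym2.eq_swap]

lemma PathJoinedE.of_mem {F : Finset (Sym2 V)} {u x : V} (hux : u ≠ x) (h : s(u, x) ∈ F) :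
    PathJoinedE F u x := by
  refine ⟨1, le_rfl, fun i => if i = 0 then u else x, fun i hi j hj h => ?_, by simp, by simp,
    fun i hi => ?_⟩
  · interval_cases i <;> interval_cases j <;> simp_all
  · interval_cases i
    simpa

/-- In a `2`-matching, the path leaving an end vertex `u` has a unique other end. -/
lemma PathJoinedE.unique {F : Finset (Sym2 V)} (hF : ∀ v, degE F v ≤ 2) {u x y : V}
    (hu : degE F u ≤ 1) (hx : degE F x ≤ 1) (hy : degE F y ≤ 1)
    (hux : PathJoinedE F u x) (huy : PathJoinedE F u y) : x = y := by
  obtain ⟨m, hm, f, hf, hf0, hfm, hfF⟩ := hux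
  obtain ⟨n, hn, g, hg, hg0, hgn, hgF⟩ := huy
  have hagree : ∀ i, (i ≤ m → i ≤ n → f i = g i) ∧
      (i + 1 ≤ m → i + 1 ≤ n → f (i + 1) = g (i + 1)) := by
    intro i
    induction i with
    | zero =>
      refine ⟨fun _ _ => hf0.trans hg0.symm, fun _ _ => ?_⟩
      have h1 := hfF 0 (by omega)
      have h2 := hgF 0 (by omega)
      rw [hf0] at h1
      rw [hg0] at h2
      exact eq_of_degE_le_one hu h1 h2
    | succ i ih =>
      refine ⟨ih.2, fun h1 h2 => ?_⟩
      have e0 := ih.1 (by omega) (by omega)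
      have e1 := ih.2 (by omega) (by omega)
      have a := hfF i (by omega)
      have b := hfF (i + 1) (by omega)
      have c := hgF (i + 1) (by omega)
      rw [Sym2.eq_swap] at a
      rw [← e1] at c
      have hne : f i ≠ f (i + 1 + 1) := fun h => by
        have := hf _ (by omega) _ (by omega) h
        omega
      rcases eq_or_eq_of_degE_le_two (hF _) hne a b c (Sym2.mem_mk_left _ _) with h | h
      · have h' := Sym2.congr_right.1 h
        rw [e0] at h'
        have := hg _ (by omega) _ (by omega) h'
        omega
      · exact (Sym2.congr_right.1 h).symm
  have inner_deg : ∀ (k : ℕ) (p : ℕ → V) (i : ℕ), (∀ i ≤ k, ∀ j ≤ k, p i = p j → i = j) →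
      (∀ i < k, s(p i, p (i + 1)) ∈ F) → 1 ≤ i → i < k → ¬ degE F (p i) ≤ 1 := by
    intro k p i hp hpF h1 h2 hdeg
    obtain ⟨i, rfl⟩ : ∃ j, i = j + 1 := ⟨i - 1, by omega⟩
    have a := hpF i (by omega)
    rw [Sym2.eq_swap] at a
    have := hp _ (by omega) _ (by omega) (eq_of_degE_le_one hdeg a (hpF (i + 1) h2))
    omega
  rcases lt_trichotomy m n with h | h | h
  · exact absurd (by rwa [← (hagree m).1 le_rfl h.le, hfm]) (inner_deg n g m hg hgF hm h)
  · subst h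
    rw [← hfm, ← hgn]
    exact (hagree m).1 le_rfl le_rfl
  · exact absurd (by rwa [(hagree n).1 h.le le_rfl, hgn]) (inner_deg m f n hf hfF hn h)

/-- Adding an edge between vertices that are not joined by a path keeps an edge set acyclic. -/
lemma AcyclicE.insert {F : Finset (Sym2 V)} (hF : AcyclicE F) {u x : V}
    (hux : ¬ PathJoinedE F u x) : AcyclicE (insert s(u, x) F) := by
  intro C hCF hC
  obtain ⟨m, hm, g, hg, hgC⟩ := hC.exists_periodic
  have heC : s(u, x) ∈ C := by
    by_contra h
    exact hF C ((Finset.subset_insert_iff_of_notMem h).1 hCF) hC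
  obtain ⟨i, hi⟩ := (hgC _).1 heC
  have hmod : ∀ a b, g (i + a) = g (i + b) ↔ a % m = b % m := fun a b =>
    (hg _ _).trans ⟨fun h => Nat.ModEq.add_left_cancel' i h, fun h => Nat.ModEq.add_left i h⟩
  have hjoin : PathJoinedE F (g (i + 1)) (g i) := by
    refine ⟨m - 1, by omega, fun j => g (i + (1 + j)), fun a ha b hb h => ?_, by simp,
      (hmod _ 0).2 ?_, fun j hj => ?_⟩
    · have h := (hmod _ _).1 h
      have h : a % m = b % m := Nat.ModEq.add_left_cancel' 1 h
      rwa [Nat.mod_eq_of_lt (by omega), Nat.mod_eq_of_lt (by omega)] at h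
    · rw [show 1 + (m - 1) = m by omega]
      simp
    · refine (Finset.mem_insert.1 (hCF ((hgC _).2 ⟨i + (1 + j), rfl⟩))).resolve_left fun h => ?_
      rw [hi, Sym2.eq_iff] at h
      have h0 : ∀ a, g (i + a) = g i ↔ a % m = 0 := fun a => by simpa using hmod a 0
      rcases h with ⟨h, -⟩ | ⟨h, h'⟩
      · rw [h0, Nat.mod_eq_of_lt (by omega)] at h
        omega
      · rw [hmod, Nat.mod_eq_of_lt (by omega), Nat.mod_eq_of_lt (by omega)] at h
        have h' : g (i + (1 + j + 1)) = g i := h'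
        rw [h0, Nat.mod_eq_of_lt (by omega)] at h'
        omega
  rcases Sym2.eq_iff.1 hi with ⟨rfl, rfl⟩ | ⟨rfl, rfl⟩
  · exact hux hjoin.symm
  · exact hux hjoin

lemma degE_union_of_disjoint {A B : Finset (Sym2 V)} (h : Disjoint A B) (v : V) :
    degE (A ∪ B) v = degE A v + degE B v := by
  unfold degE
  rw [Finset.filter_union, Finset.card_union_of_disjoint (Finset.disjoint_filter_filter h)]

lemma degE_sdiff_add {A B : Finset (Sym2 V)} (h : B ⊆ A) (v : V) :
    degE (A \ B) v + degE B v = degE A v := by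
  rw [← degE_union_of_disjoint Finset.sdiff_disjoint, Finset.sdiff_union_of_subset h]

lemma degE_eq_zero_iff {F : Finset (Sym2 V)} {v : V} : degE F v = 0 ↔ ∀ e ∈ F, v ∉ e := by
  simp [degE, Finset.filter_eq_empty_iff]

lemma spanningE_of_degE_pos {F : Finset (Sym2 V)} (h : ∀ v, 1 ≤ degE F v) : SpanningE F := by
  refine Set.eq_univ_of_forall fun v => ?_
  by_contra hv
  have := degE_eq_zero_iff.2 fun e he hve => hv ⟨e, he, hve⟩
  have := h v
  omega

/-- Adding an edge not touching `F` to a set `F` with maximum degree one keeps that property. -/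
lemma degE_insert_le_one {F : Finset (Sym2 V)} (hF : ∀ v, degE F v ≤ 1) {e : Sym2 V}
    (he : ∀ v ∈ e, degE F v = 0) (v : V) : degE (insert e F) v ≤ 1 := by
  unfold degE at *
  rw [Finset.filter_insert]
  split_ifs with hv
  · exact (Finset.card_insert_le _ _).trans (by rw [he v hv])
  · exact hF v

/-- Exchanging a matching `F ⊆ S \ T` that hits all cycles of the `2`-factor `S`. -/
lemma pathCovers_of_exchange {S T F : Finset (Sym2 V)} {w : V} (hS : IsKFactor 2 S)
    (hT : IsPathCoverE T) (hV1T : V1E T = Set.univ \ {w}) (hFS : F ⊆ S) (hFT : Disjoint T F)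
    (hF : ∀ v, degE F v ≤ 1) (hw : degE F w = 0)
    (hhit : ∀ C ⊆ S, IsCycleE C → ∃ e ∈ C, e ∈ F) (hac : AcyclicE (T ∪ F)) :
    IsPathCoverE (S \ F) ∧ IsPathCoverE (T ∪ F) ∧ (S \ F) ∪ (T ∪ F) = S ∪ T ∧
      (S \ F) ∩ (T ∪ F) = S ∩ T ∧ V1E (S \ F) ∪ V1E (T ∪ F) = Set.univ \ {w} ∧
      V1E (S \ F) ∩ V1E (T ∪ F) = ∅ ∧ ∀ v, degE F v = 1 → v ∈ V1E (S \ F) := by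
  have hdS : ∀ v, degE (S \ F) v + degE F v = 2 := fun v => (degE_sdiff_add hFS v).trans (hS.2 v)
  have hdT := degE_union_of_disjoint hFT
  have hT1 : ∀ v, degE T v = 1 ↔ v ≠ w := fun v => by
    have := Set.ext_iff.1 hV1T v
    simpa [V1E] using this
  have hTpos : ∀ v, 1 ≤ degE T v := fun v => by
    by_contra h
    have h0 := degE_eq_zero_iff.1 (show degE T v = 0 by omega)
    obtain ⟨e, he, hve⟩ : v ∈ VsetE T := by rw [hT.2.1]; trivial
    exact h0 e he hve
  have hT2 := hT.1.2
  refine ⟨⟨⟨fun e he => hS.1 e (Finset.mem_sdiff.1 he).1, fun v => ?_⟩,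
    spanningE_of_degE_pos fun v => ?_, fun C hC hcyc => ?_⟩,
    ⟨⟨fun e he => (Finset.mem_union.1 he).elim (hT.1.1 e) fun h => hS.1 e (hFS h), fun v => ?_⟩,
      spanningE_of_degE_pos fun v => ?_, hac⟩, ?_, ?_, ?_, ?_, fun v hv => ?_⟩
  · have := hdS v
    omega
  · have := hdS v
    have := hF v
    omega
  · obtain ⟨e, heC, heF⟩ := hhit C (hC.trans Finset.sdiff_subset) hcyc
    exact (Finset.mem_sdiff.1 (hC heC)).2 heF
  · rw [hdT]
    by_cases hv : v = w
    · subst hv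
      have := hT2 v
      omega
    · have := (hT1 v).2 hv
      have := hF v
      omega
  · rw [hdT]
    have := hTpos v
    omega
  · ext e
    have := @hFS e
    simp only [Finset.mem_union, Finset.mem_sdiff]
    tauto
  · ext e
    have : e ∈ T → e ∉ F := fun h => Finset.disjoint_left.1 hFT h
    simp only [Finset.mem_union, Finset.mem_inter, Finset.mem_sdiff]
    tauto
  · ext v
    have h1 := hdS v
    have h2 := hT1 v
    have h3 := hF v
    have h4 := hTpos v
    have h5 := hT2 v
    simp only [V1E, Set.mem_union, Set.mem_ofPred_eq, Set.mem_sdiff, Set.mem_univ, true_and,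
      Set.mem_singleton_iff, hdT]
    by_cases hv : v = w
    · subst hv
      have : ¬ degE T v = 1 := fun h => h2.1 h rfl
      simp only [not_true_eq_false, iff_false]
      omega
    · have := h2.2 hv
      simp only [hv, not_false_eq_true, iff_true]
      omega
  · ext v
    have h1 := hdS v
    have h4 := hTpos v
    simp only [V1E, Set.mem_inter_iff, Set.mem_ofPred_eq, hdT, Set.mem_empty_iff_false, iff_false]
    omega
  · have := hdS v
    change degE (S \ F) v = 1
    omega

/-- For a `2`-factor `S` with a cycle `D` and a path cover `T` whose vertices off `D` all have
degree one, an admissible edge `f` extends to a matching `F ⊆ S \ T` avoiding `D` and hitting all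
other cycles of `S`, such that `T ∪ F` is acyclic. -/
lemma exists_matching_hitting_cycles {S T D : Finset (Sym2 V)} {f : Sym2 V} (hS : IsKFactor 2 S)
    (hD : IsCycleE D) (hDS : D ⊆ S) (hT2 : ∀ v, degE T v ≤ 2)
    (hT1 : ∀ v, v ∉ VsetE D → degE T v = 1) (hfS : f ∈ S) (hfT : f ∉ T)
    (hfD : ∀ v ∈ f, v ∉ VsetE D) (hac : AcyclicE (insert f T)) :
    ∃ F ⊆ S, f ∈ F ∧ Disjoint T F ∧ (∀ v, degE F v ≤ 1) ∧ (∀ v ∈ VsetE D, degE F v = 0) ∧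
      AcyclicE (T ∪ F) ∧ ∀ C ⊆ S, IsCycleE C → C ≠ D → ∃ e ∈ C, e ∈ F := by
  classical
  let Adm : Finset (Sym2 V) → Prop := fun F => f ∈ F ∧ Disjoint T F ∧ (∀ v, degE F v ≤ 1) ∧
    (∀ v ∈ VsetE D, degE F v = 0) ∧ AcyclicE (T ∪ F)
  have hne : (S.powerset.filter Adm).Nonempty := by
    refine ⟨{f}, Finset.mem_filter.2 ⟨by simpa using hfS, by simp, by simpa using hfT,
      fun v => ?_, fun v hv => ?_, ?_⟩⟩
    · exact (Finset.card_filter_le _ _).trans (by simp)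
    · rw [degE_eq_zero_iff]
      intro e he hve
      rw [Finset.mem_singleton.1 he] at hve
      exact hfD v hve hv
    · rwa [Finset.union_singleton]
  obtain ⟨F, hFmem, hmax⟩ := Finset.exists_max_image _ Finset.card hne
  obtain ⟨hFS, hfF, hTF, hF1, hFD, hFac⟩ := Finset.mem_filter.1 hFmem
  rw [Finset.mem_powerset] at hFS
  refine ⟨F, hFS, hfF, hTF, hF1, hFD, hFac, fun C hCS hC hCD => ?_⟩
  by_contra! hmiss
  have hCD' : ∀ v ∈ VsetE C, v ∉ VsetE D := fun v hv hvD =>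
    hCD (hC.eq_of_isKFactor hS hCS hD hDS hv hvD)
  have hC0 : ∀ v ∈ VsetE C, degE F v = 0 := fun v hv => degE_eq_zero_iff.2 fun e he hve =>
    hmiss e (hC.mem_of_isKFactor hS hCS hv (hFS he) hve) he
  have hd := degE_union_of_disjoint hTF
  have hC1 : ∀ v ∈ VsetE C, degE (T ∪ F) v ≤ 1 := fun v hv => by
    rw [hd, hC0 v hv, hT1 v (hCD' v hv)]
  have hd2 : ∀ v, degE (T ∪ F) v ≤ 2 := fun v => by
    rw [hd]
    by_cases hv : v ∈ VsetE D
    · rw [hFD v hv]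
      exact hT2 v
    · have := hT1 v hv
      have := hF1 v
      omega
  have hjoin : ∀ u x, s(u, x) ∈ C → PathJoinedE (T ∪ F) u x := by
    intro u x hux
    by_contra hnj
    have hne : u ≠ x := fun h => hS.1 _ (hCS hux) (by simp [h])
    have hnot : s(u, x) ∉ T ∪ F := fun h => hnj (.of_mem hne h)
    rw [Finset.mem_union, not_or] at hnot
    have hux0 : ∀ v ∈ s(u, x), degE F v = 0 := fun v hv => hC0 v ⟨_, hux, hv⟩
    have hlarger : insert s(u, x) F ∈ S.powerset.filter Adm := by
      refine Finset.mem_filter.2 ⟨Finset.mem_powerset.2 (Finset.insert_subset (hCS hux) hFS),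
        Finset.mem_insert_of_mem hfF, Finset.disjoint_insert_right.2 ⟨hnot.1, hTF⟩,
        degE_insert_le_one hF1 hux0, fun v hv => ?_, ?_⟩
      · rw [degE_eq_zero_iff]
        intro e he hve
        rcases Finset.mem_insert.1 he with rfl | he
        · exact hCD' v ⟨_, hux, hve⟩ hv
        · exact degE_eq_zero_iff.1 (hFD v hv) e he hve
      · rw [Finset.union_insert]
        exact hFac.insert hnj
    have := hmax _ hlarger
    rw [Finset.card_insert_of_notMem hnot.2] at this
    omega
  obtain ⟨e, he⟩ := hC.nonempty
  induction e with | _ u z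
  obtain ⟨x, y, hxy, hx, hy⟩ := hC.exists_neighbors (u := u) ⟨_, he, Sym2.mem_mk_left _ _⟩
  exact hxy (PathJoinedE.unique hd2 (hC1 u ⟨_, he, Sym2.mem_mk_left _ _⟩)
    (hC1 x ⟨_, hx, Sym2.mem_mk_right _ _⟩) (hC1 y ⟨_, hy, Sym2.mem_mk_right _ _⟩)
    (hjoin u x hx) (hjoin u y hy))

lemma isPathE_pair {a b c : V} (hab : a ≠ b) (hac : a ≠ c) (hbc : b ≠ c) :
    IsPathE {s(a, b), s(b, c)} a c := by
  refine ⟨2, by norm_num, fun i => if i = 0 then a else if i = 1 then b else c,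
    fun i hi j hj h => ?_, by simp, by simp, ?_⟩
  · interval_cases i <;> interval_cases j <;> simp_all
  · simp [Finset.range_add_one, Finset.pair_comm]

lemma IsPathE.pathJoinedE {F P : Finset (Sym2 V)} {a b : V} (h : IsPathE P a b) (hPF : P ⊆ F) :
    PathJoinedE F a b := by
  obtain ⟨m, hm, f, hf, h0, h1, rfl⟩ := h
  exact ⟨m, hm, f, hf, h0, h1, fun i hi =>
    hPF (Finset.mem_image_of_mem _ (Finset.mem_range.2 hi))⟩

/-- Lemma 10 of the paper. -/
theorem stmt8 (S Cstar Cstar2 T' : Finset (Sym2 V)) (v0 v1 v2 v3 v4 v5 : V)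
    (f' : Sym2 V) (q : V)
    (hS : IsKFactor 2 S) (hSnot : ¬ IsTourE S)
    (hdist : v1 ≠ v2 ∧ v1 ≠ v3 ∧ v1 ≠ v4 ∧ v2 ≠ v3 ∧ v2 ≠ v4 ∧ v3 ≠ v4)
    (hCstar : IsCycleE Cstar) (hCstarS : Cstar ⊆ S)
    (hP : ({s(v1, v2), s(v2, v3), s(v3, v4)} : Finset (Sym2 V)) ⊆ Cstar)
    (hv0 : s(v0, v1) ∈ Cstar) (hv5 : s(v4, v5) ∈ Cstar)
    (hv02 : v0 ≠ v2) (hv53 : v5 ≠ v3)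
    (hT' : IsPathCoverE T') (hT'23 : s(v2, v3) ∈ T') (hT'34 : s(v3, v4) ∈ T')
    (hV1T' : V1E T' = Set.univ \ {v3})
    (hCstar2 : IsCycleE Cstar2) (hCstar2S : Cstar2 ⊆ S) (hne : Cstar2 ≠ Cstar)
    (hf' : f' ∈ Cstar2) (hf'T' : f' ∉ T') (hq : q ∈ f')
    (hins : IsPathCoverE (insert f' T')) :
    ∃ S1' S2' T1' T2' : Finset (Sym2 V),
      IsPathCoverE S1' ∧ IsPathCoverE S2' ∧ IsPathCoverE T1' ∧ IsPathCoverE T2' ∧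
      (S1' ∪ T1' = S ∪ T') ∧ (S1' ∩ T1' = S ∩ T') ∧
      (S2' ∪ T2' = S ∪ T') ∧ (S2' ∩ T2' = S ∩ T') ∧
      (V1E S1' ∪ V1E T1' = Set.univ \ {v3}) ∧ (V1E S1' ∩ V1E T1' = ∅) ∧
      (V1E S2' ∪ V1E T2' = Set.univ \ {v3}) ∧ (V1E S2' ∩ V1E T2' = ∅) ∧
      (T1' \ T2' = {s(v1, v2)}) ∧ (T2' \ T1' = {s(v4, v5)}) ∧
      MaxPathE (T1' ∩ T2') ({s(v2, v3), s(v3, v4)} : Finset (Sym2 V)) ∧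
      q ∈ V1E S1' ∧ q ∈ V1E S2' := by
  obtain ⟨h12, h13, h14, h23, h24, h34⟩ := hdist
  have h12C : s(v1, v2) ∈ Cstar := hP (by simp)
  have h23C : s(v2, v3) ∈ Cstar := hP (by simp)
  have h34C : s(v3, v4) ∈ Cstar := hP (by simp)
  have h1V : v1 ∈ VsetE Cstar := ⟨_, h12C, by simp⟩
  have h2V : v2 ∈ VsetE Cstar := ⟨_, h12C, by simp⟩
  have h3V : v3 ∈ VsetE Cstar := ⟨_, h34C, by simp⟩
  have h4V : v4 ∈ VsetE Cstar := ⟨_, h34C, by simp⟩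
  have h5V : v5 ∈ VsetE Cstar := ⟨_, hv5, by simp⟩
  have h52 : v5 ≠ v2 := by
    rintro rfl
    rcases eq_or_eq_of_degE_le_two (hS.2 v5).le h13 (hCstarS (Sym2.eq_swap ▸ h12C))
      (hCstarS h23C) (hCstarS hv5) (Sym2.mem_mk_right _ _) with h | h <;>
    rw [Sym2.eq_swap, Sym2.congr_right] at h
    · exact h14 h.symm
    · exact h34 h.symm
  have hT1 : ∀ v, v ≠ v3 → degE T' v = 1 := fun v hv => by
    have : v ∈ V1E T' := by rw [hV1T']; exact ⟨trivial, hv⟩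
    exact this
  obtain ⟨F, hFS, hfF, hTF, hF1, hFD, hFac, hhit⟩ :=
    exists_matching_hitting_cycles hS hCstar hCstarS hT'.1.2
      (fun v hv => hT1 v fun h => hv (h ▸ h3V)) (hCstar2S hf') hf'T'
      (fun v hv hvC => hne (hCstar2.eq_of_isKFactor hS hCstar2S hCstar hCstarS ⟨_, hf', hv⟩ hvC))
      hins.2.2
  have hd := degE_union_of_disjoint hTF
  have hdC : ∀ v ∈ VsetE Cstar, v ≠ v3 → degE (T' ∪ F) v ≤ 1 := fun v hv hv3 => by
    rw [hd, hFD v hv, hT1 v hv3]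
  have hd2 : ∀ v, degE (T' ∪ F) v ≤ 2 := fun v => by
    rw [hd]
    by_cases hv : v = v3
    · subst hv
      rw [hFD v h3V]
      exact hT'.1.2 v
    · have := hT1 v hv
      have := hF1 v
      omega
  have hpath := isPathE_pair h23 h24 h34
  have hpathM : ({s(v2, v3), s(v3, v4)} : Finset (Sym2 V)) ⊆ T' ∪ F := by
    simp [Finset.insert_subset_iff, hT'23, hT'34]
  have hj24 := hpath.pathJoinedE hpathM
  have hnj12 : ¬ PathJoinedE (T' ∪ F) v1 v2 := fun h => h14
    (PathJoinedE.unique hd2 (hdC v2 h2V h23) (hdC v1 h1V h13) (hdC v4 h4V h34.symm) h.symm hj24)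
  have hnj45 : ¬ PathJoinedE (T' ∪ F) v4 v5 := fun h => h52
    (PathJoinedE.unique hd2 (hdC v4 h4V h34.symm) (hdC v5 h5V hv53) (hdC v2 h2V h23) h hj24.symm)
  have h45 : v4 ≠ v5 := fun h => hS.1 _ (hCstarS hv5) (by simp [h])
  have h12M : s(v1, v2) ∉ T' ∪ F := fun h => hnj12 (.of_mem h12 h)
  have h45M : s(v4, v5) ∉ T' ∪ F := fun h => hnj45 (.of_mem h45 h)
  have hneq : s(v1, v2) ≠ s(v4, v5) := fun h => by
    rcases Sym2.eq_iff.1 h with h | h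
    · exact h14 h.1
    · exact h24 h.2
  have hexch : ∀ a b : V, s(a, b) ∈ Cstar → s(a, b) ∉ T' ∪ F → v3 ∉ s(a, b) →
      ¬ PathJoinedE (T' ∪ F) a b → _ := fun a b hab habM h3ab hnj =>
    pathCovers_of_exchange (F := insert s(a, b) F) hS hT' hV1T'
      (Finset.insert_subset (hCstarS hab) hFS)
      (Finset.disjoint_insert_right.2 ⟨fun h => habM (Finset.mem_union_left _ h), hTF⟩)
      (degE_insert_le_one hF1 fun v hv => hFD v ⟨_, hab, hv⟩)
      (degE_eq_zero_iff.2 fun e he => by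
        rcases Finset.mem_insert.1 he with rfl | he
        · exact h3ab
        · exact degE_eq_zero_iff.1 (hFD v3 h3V) e he)
      (fun C hCS hC => by
        by_cases h : C = Cstar
        · exact ⟨_, h ▸ hab, Finset.mem_insert_self _ _⟩
        · obtain ⟨e, heC, heF⟩ := hhit C hCS hC h
          exact ⟨e, heC, Finset.mem_insert_of_mem heF⟩)
      (by rw [Finset.union_insert]; exact hFac.insert hnj)
  have hdq : ∀ e, (∀ v, degE (insert e F) v ≤ 1) → degE (insert e F) q = 1 := fun e he => by
    refine le_antisymm (he q) (Nat.one_le_iff_ne_zero.2 fun h => ?_)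
    exact degE_eq_zero_iff.1 h f' (Finset.mem_insert_of_mem hfF) hq
  have hq12 := hdq _ (degE_insert_le_one hF1 fun v hv => hFD v ⟨_, h12C, hv⟩)
  have hq45 := hdq _ (degE_insert_le_one hF1 fun v hv => hFD v ⟨_, hv5, hv⟩)
  obtain ⟨a1, a2, a3, a4, a5, a6, a7⟩ := hexch v1 v2 h12C h12M (by simp [h13.symm, h23.symm]) hnj12
  obtain ⟨b1, b2, b3, b4, b5, b6, b7⟩ := hexch v4 v5 hv5 h45M (by simp [h34, hv53.symm]) hnj45
  have hinter : (T' ∪ insert s(v1, v2) F) ∩ (T' ∪ insert s(v4, v5) F) = T' ∪ F := by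
    rw [← Finset.union_inter_distrib_left, Finset.insert_inter_of_notMem,
      Finset.inter_insert_of_notMem,
      Finset.inter_self]
    · exact fun h => h45M (Finset.mem_union_right _ h)
    · rw [Finset.mem_insert, not_or]
      exact ⟨hneq, fun h => h12M (Finset.mem_union_right _ h)⟩
  refine ⟨_, _, _, _, a1, b1, a2, b2, a3, a4, b3, b4, a5, a6, b5, b6, ?_, ?_, ?_, a7 q hq12,
    b7 q hq45⟩
  · rw [Finset.union_insert, Finset.union_insert]
    ext e
    simp only [Finset.mem_sdiff, Finset.mem_insert, Finset.mem_singleton]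
    constructor
    · tauto
    · rintro rfl
      tauto
  · rw [Finset.union_insert, Finset.union_insert]
    ext e
    simp only [Finset.mem_sdiff, Finset.mem_insert, Finset.mem_singleton]
    constructor
    · tauto
    · rintro rfl
      have := hneq.symm
      tauto
  · rw [hinter]
    refine ⟨hpathM, ⟨_, _, hpath⟩, ?_⟩
    rintro e he ⟨v, hve, d, hd', hvd⟩
    simp only [Finset.mem_insert, Finset.mem_singleton] at hd' ⊢
    have hv : v = v2 ∨ v = v3 ∨ v = v4 := by
      rcases hd' with rfl | rfl <;> rcases Sym2.mem_iff.1 hvd with h | h <;> simp [h]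
    have m23 := hpathM (Finset.mem_insert_self _ _)
    have m34 : s(v3, v4) ∈ T' ∪ F := hpathM (by simp)
    rcases hv with rfl | rfl | rfl
    · obtain ⟨z, rfl⟩ := hve
      rw [eq_of_degE_le_one (hdC _ h2V h23) he m23]
      exact .inl rfl
    · rw [Sym2.eq_swap] at m23 ⊢
      exact eq_or_eq_of_degE_le_two (hd2 _) h24 m23 m34 he hve
    · obtain ⟨z, rfl⟩ := hve
      rw [Sym2.eq_swap] at m34
      rw [eq_of_degE_le_one (hdC _ h4V h34.symm) he m34]
      exact .inr Sym2.eq_swap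
end

section
/- Let S1 and S2 be path covers of G with 𝒫(S1) = {Q1, …, Qk, P1} and 𝒫(S2) = {Q1, …, Qk, P2}, where k ≥ 1, each Q_i is an (x_i, y_i)-path (the Q_i are common to both path covers and pairwise vertex-disjoint), P1 is a (v4, v3)-path, P2 is a (v1, v0)-path, V(P1) = V(P2), v3 ∉ {v0, v1} and v1 ∉ {v3, v4} (the case v0 = v4 is allowed). Then there exist edge sets A1, A2 ⊆ E with A1 ∩ A2 = ∅ such that: (i) S_i ∪ A_i is a tour of G for i = 1,2; (ii) V(A_i) = V1(S_i) for i = 1,2; and (iii) A1 ∪ A2 consists of a (v1, v3)-path if v0 = v4, of vertex-disjoint (v0, v3)- and (v1, v4)-paths if v0 ≠ v4 and k is odd, and of vertex-disjoint (v0, v1)- and (v3, v4)-paths if v0 ≠ v4 and k is even. Moreover, for any prescribed labeling (x1, y1) of the two endpoints of Q1, the sets A1 and A2 can be chosen so that (v3, x1) ∈ A1 and (v1, y1) ∈ A2. -/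
variable {V : Type*} [Fintype V] [DecidableEq V]

set_option linter.unusedSectionVars false

/-- Inductive description of the edge sets of simple paths, growing at the second endpoint. -/
inductive EdgePath : Finset (Sym2 V) → V → V → Prop
  | single {a b : V} (h : a ≠ b) : EdgePath {s(a, b)} a b
  | snoc {F : Finset (Sym2 V)} {a c b : V} (h : EdgePath F a c) (hb : b ∉ VsetE F) :
      EdgePath (insert s(c, b) F) a b

theorem mem_VsetE_insert {F : Finset (Sym2 V)} {a b v : V} :
    v ∈ VsetE (insert s(a, b) F) ↔ v = a ∨ v = b ∨ v ∈ VsetE F := by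
  simp [VsetE, or_assoc]

theorem mem_VsetE_singleton {a b v : V} :
    v ∈ VsetE ({s(a, b)} : Finset (Sym2 V)) ↔ v = a ∨ v = b := by
  simp [VsetE]

theorem mem_VsetE_union {F G : Finset (Sym2 V)} {v : V} :
    v ∈ VsetE (F ∪ G) ↔ v ∈ VsetE F ∨ v ∈ VsetE G := by
  simp [VsetE, or_and_right, exists_or]

namespace EdgePath

variable {F G : Finset (Sym2 V)} {a b c d : V}

theorem left_mem (h : EdgePath F a b) : a ∈ VsetE F := by
  induction h with
  | single h => simp [mem_VsetE_singleton]
  | snoc h hb ih => simp [mem_VsetE_insert, ih]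

theorem right_mem (h : EdgePath F a b) : b ∈ VsetE F := by
  cases h with
  | single h => simp [mem_VsetE_singleton]
  | snoc h hb => simp [mem_VsetE_insert]

theorem ne (h : EdgePath F a b) : a ≠ b := by
  cases h with
  | single h => exact h
  | snoc h hb => rintro rfl; exact hb h.left_mem

theorem cons (h : EdgePath F b c) (ha : a ∉ VsetE F) : EdgePath (insert s(a, b) F) a c := by
  induction h with
  | @single b c h =>
    rw [mem_VsetE_singleton, not_or] at ha
    have := (single ha.1).snoc (b := c) (by
      rw [mem_VsetE_singleton]; rintro (h' | h')
      · exact ha.2 h'.symm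
      · exact h h'.symm)
    rwa [Finset.pair_comm] at this
  | @snoc F b c d h hb ih =>
    rw [mem_VsetE_insert] at ha
    push Not at ha
    rw [Finset.insert_comm]
    refine (ih ha.2.2).snoc ?_
    rw [mem_VsetE_insert]
    rintro (rfl | rfl | h')
    · exact ha.2.1 rfl
    · exact hb h.left_mem
    · exact hb h'

theorem symm (h : EdgePath F a b) : EdgePath F b a := by
  induction h with
  | single h => rw [Sym2.eq_swap]; exact single h.symm
  | snoc h hb ih => rw [Sym2.eq_swap]; exact ih.cons hb

theorem append (hF : EdgePath F a b) (hG : EdgePath G c d) (hd : Disjoint (VsetE F) (VsetE G)) :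
    EdgePath (insert s(b, c) (F ∪ G)) a d := by
  induction hG with
  | @single c d h =>
    rw [Set.disjoint_right] at hd
    have h1 := hF.snoc (hd (a := c) (by simp [mem_VsetE_singleton]))
    have h2 := h1.snoc (b := d) (by
      rw [mem_VsetE_insert]
      rintro (rfl | rfl | h')
      · exact hd (by simp [mem_VsetE_singleton]) hF.right_mem
      · exact h rfl
      · exact hd (by simp [mem_VsetE_singleton]) h')
    convert h2 using 1
    ext e; simp; tauto
  | @snoc G c e d h hb ih =>
    have hd' : Disjoint (VsetE F) (VsetE G) := by
      refine hd.mono_right fun v hv => ?_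
      simp [mem_VsetE_insert, hv]
    have h2 := (ih hd').snoc (b := d) (by
      rw [mem_VsetE_insert, mem_VsetE_union]
      have hdF : d ∉ VsetE F := Set.disjoint_right.1 hd (by simp [mem_VsetE_insert])
      rintro (rfl | rfl | h' | h')
      · exact hdF hF.right_mem
      · exact hb h.left_mem
      · exact hdF h'
      · exact hb h')
    convert h2 using 1
    ext e; simp; tauto

theorem of_injOn (f : ℕ → V) (m : ℕ) (hf : ∀ i ≤ m + 1, ∀ j ≤ m + 1, f i = f j → i = j) :
    EdgePath ((Finset.range (m + 1)).image fun i => s(f i, f (i + 1))) (f 0) (f (m + 1)) := by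
  induction m with
  | zero =>
    simp only [zero_add, Finset.range_one, Finset.image_singleton]
    exact single fun h => by have := hf 0 (by simp) 1 (by simp) h; omega
  | succ m ih =>
    rw [Finset.range_add_one, Finset.image_insert]
    refine (ih fun i hi j hj => hf i (by omega) j (by omega)).snoc ?_
    rintro ⟨e, he, hv⟩
    obtain ⟨i, hi, rfl⟩ := Finset.mem_image.1 he
    rw [Finset.mem_range] at hi
    rcases Sym2.mem_iff.1 hv with h | h
    · have := hf _ le_rfl i (by omega) h; omega
    · have := hf _ le_rfl (i + 1) (by omega) h; omega

end EdgePath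

theorem IsPathE.edgePath {F : Finset (Sym2 V)} {a b : V} (h : IsPathE F a b) :
    EdgePath F a b := by
  obtain ⟨m, hm, f, hf, rfl, rfl, rfl⟩ := h
  obtain ⟨m, rfl⟩ := Nat.exists_eq_add_of_le' hm
  exact .of_injOn f m hf

theorem EdgePath.exists_parametrization {F : Finset (Sym2 V)} {a b : V} (h : EdgePath F a b) :
    ∃ m : ℕ, 1 ≤ m ∧ ∃ f : ℕ → V, (∀ i ≤ m, ∀ j ≤ m, f i = f j → i = j) ∧ f 0 = a ∧ f m = b ∧
      F = (Finset.range m).image (fun i => s(f i, f (i + 1))) ∧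
      ∀ v, v ∈ VsetE F ↔ ∃ i ≤ m, f i = v := by
  induction h with
  | @single a b h =>
    refine ⟨1, le_rfl, fun i => if i = 0 then a else b, ?_, by simp, by simp, by simp, ?_⟩
    · intro i hi j hj
      interval_cases i <;> interval_cases j <;> simp [h, h.symm]
    · intro v
      rw [mem_VsetE_singleton]
      constructor
      · rintro (rfl | rfl)
        · exact ⟨0, by simp⟩
        · exact ⟨1, by simp⟩
      · rintro ⟨i, hi, rfl⟩
        interval_cases i <;> simp
  | @snoc F a c b h hb ih =>
    obtain ⟨m, hm, f, hf, rfl, rfl, hF, hV⟩ := ih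
    have hbf : ∀ i ≤ m, f i ≠ b := fun i hi h' => hb ((hV b).2 ⟨i, hi, h'⟩)
    have hg : ∀ i ≤ m, (if i ≤ m then f i else b) = f i := fun i hi => if_pos hi
    refine ⟨m + 1, by omega, fun i => if i ≤ m then f i else b, ?_, by simp, by simp, ?_, ?_⟩
    · intro i hi j hj hij
      dsimp only at hij
      split_ifs at hij with h1 h2 h2
      · exact hf i h1 j h2 hij
      · exact absurd hij (hbf i h1)
      · exact absurd hij.symm (hbf j h2)
      · omega
    · rw [Finset.range_add_one, Finset.image_insert]
      congr 1
      · simp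
      · rw [hF]
        refine Finset.image_congr fun i hi => ?_
        have hi : i < m := by simpa using hi
        simp [hi.le, Nat.succ_le_of_lt hi]
    · intro v
      rw [mem_VsetE_insert, hV]
      constructor
      · rintro (rfl | rfl | ⟨i, hi, rfl⟩)
        · exact ⟨m, by simp⟩
        · exact ⟨m + 1, by simp⟩
        · exact ⟨i, by omega, hg i hi⟩
      · rintro ⟨i, hi, rfl⟩
        by_cases h1 : i ≤ m
        · exact .inr (.inr ⟨i, h1, (hg i h1).symm⟩)
        · exact .inr (.inl (if_neg h1))

theorem EdgePath.isPathE {F : Finset (Sym2 V)} {a b : V} (h : EdgePath F a b) :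
    IsPathE F a b := by
  obtain ⟨m, hm, f, hf, ha, hb, hF, -⟩ := h.exists_parametrization
  exact ⟨m, hm, f, hf, ha, hb, hF⟩

/-- Joining the endpoints of a path with a further vertex closes it to a cycle. -/
theorem EdgePath.isCycleE {F : Finset (Sym2 V)} {a b c : V} (h : EdgePath F a b)
    (hc : c ∈ VsetE F) (hca : c ≠ a) (hcb : c ≠ b) : IsCycleE (insert s(b, a) F) := by
  obtain ⟨m, hm, f, hf, rfl, rfl, hF, hV⟩ := h.exists_parametrization
  obtain ⟨i, hi, rfl⟩ := (hV c).1 hc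
  have hi0 : i ≠ 0 := fun h => hca (h ▸ rfl)
  have him : i ≠ m := fun h => hcb (h ▸ rfl)
  refine ⟨m + 1, by omega, f, fun i hi j hj => hf i (by omega) j (by omega), ?_⟩
  rw [Finset.range_add_one, Finset.image_insert, Nat.mod_self, hF]
  congr 1
  refine Finset.image_congr fun i hi => ?_
  have hi : i < m := by simpa using hi
  simp [Nat.mod_eq_of_lt (Nat.add_lt_add_right hi 1)]

theorem degE_insert {F : Finset (Sym2 V)} {e : Sym2 V} (he : e ∉ F) (v : V) :
    degE (insert e F) v = degE F v + if v ∈ e then 1 else 0 := by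
  unfold degE
  rw [Finset.filter_insert]
  split_ifs with h
  · rw [Finset.card_insert_of_notMem (by simp [he])]
  · rfl

theorem degE_eq_zero {F : Finset (Sym2 V)} {v : V} (hv : v ∉ VsetE F) : degE F v = 0 := by
  rw [degE, Finset.card_eq_zero, Finset.filter_eq_empty_iff]
  exact fun e he h => hv ⟨e, he, h⟩

theorem EdgePath.degE_eq {F : Finset (Sym2 V)} {a b : V} (h : EdgePath F a b) :
    ∀ v ∈ VsetE F, degE F v = if v = a ∨ v = b then 1 else 2 := by
  induction h with
  | @single a b h =>
    intro v hv
    rw [mem_VsetE_singleton] at hv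
    rw [if_pos hv, ← insert_empty_eq, degE_insert (by simp), if_pos (by simpa using hv)]
    simp [degE]
  | @snoc F a c b h hb ih =>
    intro v hv
    rw [mem_VsetE_insert] at hv
    have hbF : s(c, b) ∉ F := fun h' => hb ⟨_, h', by simp⟩
    have hca := h.ne
    have hbc : c ≠ b := fun h' => hb (h' ▸ h.right_mem)
    have hab : a ≠ b := fun h' => hb (h' ▸ h.left_mem)
    simp only [degE_insert hbF, Sym2.mem_iff]
    by_cases h1 : v = b
    · subst h1
      simp [degE_eq_zero hb]
    · by_cases h2 : v = c
      · subst h2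
        simp [ih _ h.right_mem, h1, hca.symm]
      · rw [ih v (by tauto)]
        simp [h1, h2]

theorem MaxPathE.degE_eq {S P : Finset (Sym2 V)} (h : MaxPathE S P) {v : V} (hv : v ∈ VsetE P) :
    degE S v = degE P v := by
  unfold degE
  congr 1
  ext e
  simp only [Finset.mem_filter]
  exact ⟨fun ⟨he, hve⟩ => ⟨h.2.2 e he ⟨v, hve, hv⟩, hve⟩, fun ⟨he, hve⟩ => ⟨h.1 he, hve⟩⟩

theorem EdgePath.subset_of_maxPathE {S P F : Finset (Sym2 V)} {a b : V} (h : EdgePath F a b)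
    (hP : MaxPathE S P) (hF : F ⊆ S) {v : V} (hvF : v ∈ VsetE F) (hvP : v ∈ VsetE P) : F ⊆ P := by
  induction h generalizing v with
  | @single a b h =>
    rw [Finset.singleton_subset_iff] at hF ⊢
    exact hP.2.2 _ hF ⟨v, by simpa [mem_VsetE_singleton] using hvF, hvP⟩
  | @snoc F a c b h hb ih =>
    rw [Finset.insert_subset_iff] at hF ⊢
    rw [mem_VsetE_insert, ← or_assoc] at hvF
    rcases hvF with hv | hv
    · have hcb := hP.2.2 _ hF.1 ⟨v, by simpa using hv, hvP⟩
      exact ⟨hcb, ih hF.2 h.right_mem ⟨_, hcb, by simp⟩⟩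
    · have hFP := ih hF.2 hv hvP
      obtain ⟨e, he, hce⟩ := h.right_mem
      exact ⟨hP.2.2 _ hF.1 ⟨c, by simp, e, hFP he, hce⟩, hFP⟩

theorem MaxPathE.eq_of_mem {S P P' : Finset (Sym2 V)} (h : MaxPathE S P) (h' : MaxPathE S P')
    {v : V} (hv : v ∈ VsetE P) (hv' : v ∈ VsetE P') : P = P' := by
  obtain ⟨-, ⟨a, b, hp⟩, -⟩ := id h
  obtain ⟨-, ⟨c, d, hp'⟩, -⟩ := id h'
  exact (hp.edgePath.subset_of_maxPathE h' h.1 hv hv').antisymm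
    (hp'.edgePath.subset_of_maxPathE h h'.1 (v := v) hv' hv)

/-- In a path of maximum size inside a path cover, an edge at an endpoint is an edge of the path. -/
theorem EdgePath.mem_of_right_mem {S P : Finset (Sym2 V)} (hS : IsPathCoverE S) {a b : V}
    (hP : EdgePath P a b) (hPS : P ⊆ S)
    (hmax : ∀ F a b, EdgePath F a b → F ⊆ S → P ⊆ F → F ⊆ P)
    (hint : ∀ e ∈ S, ∀ v ∈ e, v ∈ VsetE P → v ≠ a → v ≠ b → e ∈ P)
    {e : Sym2 V} (he : e ∈ S) (hb : b ∈ e) : e ∈ P := by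
  obtain ⟨w, rfl⟩ := Sym2.mem_iff_exists.1 hb
  have hwb : w ≠ b := fun h => hS.1.1 _ he (by simp [h])
  by_cases hw : w ∈ VsetE P
  · by_cases hwa : w = a
    · subst hwa
      by_contra heP
      by_cases hc : ∃ c ∈ VsetE P, c ≠ w ∧ c ≠ b
      · obtain ⟨c, hc, hcw, hcb⟩ := hc
        exact hS.2.2 _ (Finset.insert_subset he hPS) (hP.isCycleE hc hcw hcb)
      · push Not at hc
        obtain ⟨e, heP', hwe⟩ := hP.left_mem
        obtain ⟨z, rfl⟩ := Sym2.mem_iff_exists.1 hwe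
        have hzw : z ≠ w := fun h => hS.1.1 _ (hPS heP') (by simp [h])
        have hzb := hc z ⟨_, heP', by simp⟩ hzw
        subst hzb
        exact heP (Sym2.eq_swap ▸ heP')
    · exact hint _ he w (by simp) hw hwa hwb
  · exact hmax _ _ _ (hP.snoc hw) (Finset.insert_subset he hPS) (Finset.subset_insert _ _)
      (Finset.mem_insert_self _ _)

theorem IsPathCoverE.exists_maxPathE {S : Finset (Sym2 V)} (hS : IsPathCoverE S) {e : Sym2 V}
    (he : e ∈ S) : ∃ P, MaxPathE S P ∧ e ∈ P := by
  classical
  let T := S.powerset.filter fun P => e ∈ P ∧ ∃ a b, EdgePath P a b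
  have hT : T.Nonempty := by
    refine ⟨{e}, ?_⟩
    simp only [T, Finset.mem_filter, Finset.mem_powerset, Finset.singleton_subset_iff]
    refine ⟨he, by simp, ?_⟩
    induction e with
    | _ a b => exact ⟨a, b, .single fun h => hS.1.1 _ he (by simp [h])⟩
  obtain ⟨P, hPT, hmaxT⟩ := T.exists_max_image Finset.card hT
  simp only [T, Finset.mem_filter, Finset.mem_powerset] at hPT hmaxT
  obtain ⟨hPS, heP, a, b, hP⟩ := hPT
  have hmax : ∀ F a b, EdgePath F a b → F ⊆ S → P ⊆ F → F ⊆ P := fun F a b hF hFS hPF =>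
    (Finset.eq_of_subset_of_card_le hPF (hmaxT F ⟨hFS, hPF heP, a, b, hF⟩)).symm.subset
  have hint : ∀ e ∈ S, ∀ v ∈ e, v ∈ VsetE P → v ≠ a → v ≠ b → e ∈ P := by
    intro e he v hve hv hva hvb
    have hd := hP.degE_eq v hv
    rw [if_neg (by tauto)] at hd
    have heq : P.filter (v ∈ ·) = S.filter (v ∈ ·) :=
      Finset.eq_of_subset_of_card_le (Finset.filter_subset_filter _ hPS)
        ((hS.1.2 v).trans hd.ge)
    have : e ∈ P.filter (v ∈ ·) := heq ▸ Finset.mem_filter.2 ⟨he, hve⟩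
    exact (Finset.mem_filter.1 this).1
  refine ⟨P, ⟨hPS, ⟨a, b, hP.isPathE⟩, ?_⟩, heP⟩
  rintro e he ⟨v, hve, hv⟩
  by_cases hvb : v = b
  · subst hvb
    exact hP.mem_of_right_mem hS hPS hmax hint he hve
  by_cases hva : v = a
  · subst hva
    exact hP.symm.mem_of_right_mem hS hPS hmax
      (fun e he u hue hu h1 h2 => hint e he u hue hu h2 h1) he hve
  exact hint e he v hve hv hva hvb

/-- The sequence `b, y 0, y 1, …`. -/
def prepend (b : V) (y : ℕ → V) : ℕ → V
  | 0 => b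
  | i + 1 => y i

/-- The edges joining `b` to `x 0` and `y i` to `x (i + 1)` for `i + 1 < n`. -/
def linkEdges (b : V) (x y : ℕ → V) (n : ℕ) : Finset (Sym2 V) :=
  (Finset.range n).image fun i => s(prepend b y i, x i)

theorem linkEdges_succ (b : V) (x y : ℕ → V) (n : ℕ) :
    linkEdges b x y (n + 1) = insert s(prepend b y n, x n) (linkEdges b x y n) := by
  rw [linkEdges, Finset.range_add_one, Finset.image_insert, linkEdges]

theorem mem_VsetE_linkEdges {b : V} {x y : ℕ → V} {n : ℕ} {v : V}
    (hv : v ∈ VsetE (linkEdges b x y n)) : v = b ∨ ∃ i < n, v = x i ∨ v = y i := by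
  obtain ⟨e, he, hve⟩ := hv
  obtain ⟨i, hi, rfl⟩ := Finset.mem_image.1 he
  rw [Finset.mem_range] at hi
  rcases Sym2.mem_iff.1 hve with h | h
  · cases i with
    | zero => exact .inl h
    | succ i => exact .inr ⟨i, by omega, .inr h⟩
  · exact .inr ⟨i, hi, .inl h⟩

theorem mem_VsetE_insert_linkEdges {a b : V} {x y : ℕ → V} {n : ℕ} {v : V} :
    v ∈ VsetE (insert s(prepend b y n, a) (linkEdges b x y n)) ↔
      v = a ∨ v = b ∨ ∃ i < n, v = x i ∨ v = y i := by
  induction n generalizing a with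
  | zero => simp [mem_VsetE_singleton, linkEdges, prepend, or_comm]
  | succ n ih =>
    rw [mem_VsetE_insert, linkEdges_succ, ih]
    simp only [prepend, Nat.lt_succ_iff_lt_or_eq, or_and_right, exists_or, exists_eq_left]
    simp only [or_assoc, or_comm, or_left_comm]

theorem edgePath_linkEdges {b : V} {u : ℕ → V} {k : ℕ} (hu : ∀ i < k, ∀ j < k, u i = u j → i = j)
    (hb : ∀ i < k, u i ≠ b) {n : ℕ} (hn : n < k) :
    EdgePath (linkEdges b u u (n + 1)) b (u n) := by
  induction n with
  | zero => simpa [linkEdges, prepend] using EdgePath.single (hb 0 hn).symm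
  | succ n ih =>
    rw [linkEdges_succ]
    refine (ih (by omega)).snoc fun h => ?_
    rcases mem_VsetE_linkEdges h with h | ⟨i, hi, h⟩
    · exact hb _ hn h
    · have := hu _ hn i (by omega) (by tauto); omega

/-- Linking the paths of a path cover in order, and closing up, yields a tour. -/
theorem isTourE_union_linkEdges {S P : Finset (Sym2 V)} {k : ℕ} {Q : ℕ → Finset (Sym2 V)}
    {x y : ℕ → V} {a b : V} (hS : SpanningE S) (hk : 1 ≤ k) (hP : EdgePath P a b)
    (hQ : ∀ i < k, EdgePath (Q i) (x i) (y i))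
    (hQdisj : ∀ i < k, ∀ j < k, i ≠ j → Disjoint (VsetE (Q i)) (VsetE (Q j)))
    (hPQ : ∀ i < k, Disjoint (VsetE P) (VsetE (Q i)))
    (hmem : ∀ e, e ∈ S ↔ e ∈ P ∨ ∃ i < k, e ∈ Q i) :
    IsTourE (S ∪ insert s(prepend b y k, a) (linkEdges b x y k)) := by
  have key : ∀ n ≤ k, EdgePath (P ∪ (Finset.range n).biUnion Q ∪ linkEdges b x y n) a
      (prepend b y n) ∧ ∀ i < k, n ≤ i →
        Disjoint (VsetE (P ∪ (Finset.range n).biUnion Q ∪ linkEdges b x y n)) (VsetE (Q i)) := by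
    intro n
    induction n with
    | zero => simpa [linkEdges, prepend] using ⟨hP, hPQ⟩
    | succ n ih =>
      intro hn
      obtain ⟨h1, h2⟩ := ih (by omega)
      have h3 := h1.append (hQ n hn) (h2 n hn le_rfl)
      have heq : P ∪ (Finset.range (n + 1)).biUnion Q ∪ linkEdges b x y (n + 1) =
          insert s(prepend b y n, x n)
            (P ∪ (Finset.range n).biUnion Q ∪ linkEdges b x y n ∪ Q n) := by
        rw [Finset.range_add_one, Finset.biUnion_insert, linkEdges_succ]
        ext e
        simp only [Finset.mem_union, Finset.mem_insert]
        tauto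
      rw [heq]
      refine ⟨h3, fun i hi hni => Set.disjoint_left.2 fun v hv => ?_⟩
      have hd2 := Set.disjoint_left.1 (h2 i hi (by omega))
      have hdn := Set.disjoint_left.1 (hQdisj n hn i hi (by omega))
      rw [mem_VsetE_insert, mem_VsetE_union] at hv
      rcases hv with rfl | rfl | hv | hv
      · exact hd2 h1.right_mem
      · exact hdn (hQ n hn).left_mem
      · exact hd2 hv
      · exact hdn hv
  have hpath := (key k le_rfl).1
  have hSeq : P ∪ (Finset.range k).biUnion Q = S := by
    ext e; simp [hmem]
  rw [hSeq] at hpath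
  rw [Finset.union_insert]
  have hSV : ∀ F, S ⊆ F → VsetE F = Set.univ := fun F hF => by
    rw [Set.eq_univ_iff_forall]
    intro v
    obtain ⟨e, he, hv⟩ := hS.symm ▸ Set.mem_univ v
    exact ⟨e, hF he, hv⟩
  refine ⟨?_, hSV _ fun e he => by simp [he]⟩
  have hd := Set.disjoint_left.1 (hPQ 0 hk)
  refine hpath.isCycleE (c := x 0) (hSV _ Finset.subset_union_left ▸ Set.mem_univ _) ?_ ?_
  · exact fun h => hd hP.left_mem (h ▸ (hQ 0 hk).left_mem)
  · obtain ⟨k, rfl⟩ := Nat.exists_eq_add_of_le' hk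
    intro h
    change x 0 = y k at h
    by_cases hk0 : k = 0
    · subst hk0; exact (hQ 0 hk).ne h
    · exact Set.disjoint_left.1 (hQdisj 0 hk k (by omega) (Ne.symm hk0)) (hQ 0 hk).left_mem
        (h ▸ (hQ k (by omega)).right_mem)

theorem mem_iff_of_maxPathE_iff {S P : Finset (Sym2 V)} {k : ℕ} {Q : ℕ → Finset (Sym2 V)}
    (hS : IsPathCoverE S) (hPS : ∀ R, MaxPathE S R ↔ (R = P ∨ ∃ i < k, R = Q i)) (e : Sym2 V) :
    e ∈ S ↔ e ∈ P ∨ ∃ i < k, e ∈ Q i := by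
  constructor
  · intro he
    obtain ⟨R, hR, heR⟩ := hS.exists_maxPathE he
    rcases (hPS R).1 hR with rfl | ⟨i, hi, rfl⟩
    · exact .inl heR
    · exact .inr ⟨i, hi, heR⟩
  · rintro (he | ⟨i, hi, he⟩)
    · exact ((hPS P).2 (.inl rfl)).1 he
    · exact ((hPS (Q i)).2 (.inr ⟨i, hi, rfl⟩)).1 he

theorem mem_V1E_iff {S P : Finset (Sym2 V)} {k : ℕ} {Q : ℕ → Finset (Sym2 V)} {x y : ℕ → V}
    {a b : V} (hS : IsPathCoverE S) (hP : EdgePath P a b)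
    (hQ : ∀ i < k, EdgePath (Q i) (x i) (y i))
    (hPS : ∀ R, MaxPathE S R ↔ (R = P ∨ ∃ i < k, R = Q i)) (v : V) :
    v ∈ V1E S ↔ v = a ∨ v = b ∨ ∃ i < k, v = x i ∨ v = y i := by
  have key : ∀ {R c d}, MaxPathE S R → EdgePath R c d → v ∈ VsetE R →
      (v ∈ V1E S ↔ v = c ∨ v = d) := by
    intro R c d hR hp hv
    change degE S v = 1 ↔ _
    rw [hR.degE_eq hv, hp.degE_eq v hv]
    split_ifs <;> simp_all
  have hmP : MaxPathE S P := (hPS P).2 (.inl rfl)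
  have hmQ : ∀ i < k, MaxPathE S (Q i) := fun i hi => (hPS (Q i)).2 (.inr ⟨i, hi, rfl⟩)
  constructor
  · intro hv
    obtain ⟨e, he, hve⟩ := hS.2.1.symm ▸ Set.mem_univ v
    rcases (mem_iff_of_maxPathE_iff hS hPS e).1 he with h | ⟨i, hi, h⟩
    · have := (key hmP hP ⟨e, h, hve⟩).1 hv
      tauto
    · exact .inr (.inr ⟨i, hi, (key (hmQ i hi) (hQ i hi) ⟨e, h, hve⟩).1 hv⟩)
  · rintro (rfl | rfl | ⟨i, hi, rfl | rfl⟩)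
    · exact (key hmP hP hP.left_mem).2 (.inl rfl)
    · exact (key hmP hP hP.right_mem).2 (.inr rfl)
    · exact (key (hmQ i hi) (hQ i hi) (hQ i hi).left_mem).2 (.inl rfl)
    · exact (key (hmQ i hi) (hQ i hi) (hQ i hi).right_mem).2 (.inr rfl)

/-- The sequence `x 0, y 1, x 2, y 3, …`. -/
def zigzag (x y : ℕ → V) (i : ℕ) : V := if Even i then x i else y i

theorem linkEdges_union_linkEdges (b c : V) (x y : ℕ → V) (n : ℕ) :
    linkEdges b x y n ∪ linkEdges c y x n =
      linkEdges b (zigzag x y) (zigzag x y) n ∪ linkEdges c (zigzag y x) (zigzag y x) n := by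
  induction n with
  | zero => rfl
  | succ n ih =>
    simp only [linkEdges_succ, Finset.insert_union, Finset.union_insert, ih]
    rcases n with _ | n
    · simp [prepend, zigzag]
    · by_cases hn : Even n
      · rw [Finset.insert_comm]
        simp [prepend, zigzag, hn, Nat.even_add_one]
      · simp [prepend, zigzag, hn, Nat.even_add_one]

theorem disjoint_linkEdges {a a' b b' : V} {x y : ℕ → V} {k : ℕ}
    (hx : ∀ i < k, ∀ j < k, x i = x j → i = j) (hy : ∀ i < k, ∀ j < k, y i = y j → i = j)
    (hxy : ∀ i < k, ∀ j < k, x i ≠ y j)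
    (hv : ∀ v ∈ ({b, b', a', a} : Set V), ∀ i < k, x i ≠ v ∧ y i ≠ v)
    (hk : 1 ≤ k) (hba : b ≠ a') (hba' : b' ≠ a) :
    insert s(prepend b y k, a) (linkEdges b x y k) ∩
      insert s(prepend b' x k, a') (linkEdges b' y x k) = ∅ := by
  obtain ⟨n, rfl⟩ := Nat.exists_eq_add_of_le' hk
  simp only [Set.mem_insert_iff, Set.mem_singleton_iff, forall_eq_or_imp, forall_eq] at hv
  obtain ⟨hb, hb', ha', ha⟩ := hv
  have hn : n < n + 1 := by omega
  rw [← Finset.disjoint_iff_inter_eq_empty, Finset.disjoint_left]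
  intro e he he'
  simp only [Finset.mem_insert, linkEdges, Finset.mem_image, Finset.mem_range] at he he'
  rcases he with rfl | ⟨i, hi, rfl⟩ <;> rcases he' with h | ⟨j, hj, h⟩ <;>
    rw [Sym2.eq_iff] at h <;> rcases h with ⟨h1, h2⟩ | ⟨h1, h2⟩
  · exact hxy n hn n hn h1.symm
  · exact (ha' n hn).2 h1
  · exact (ha j hj).2 h2
  · have := hy _ hj _ hn h2
    subst this
    cases j with
    | zero => exact hba' h1
    | succ j => exact (ha j (by omega)).1 h1
  · exact (ha' i hi).1 h2
  · have := hx _ hi _ hn h2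
    subst this
    cases i with
    | zero => exact hba h1
    | succ i => exact (ha' i (by omega)).2 h1
  · exact hxy i hi j hj h2.symm
  · cases i with
    | zero => exact (hb j hj).2 h2
    | succ i =>
      cases j with
      | zero => exact (hb' _ hi).1 h1.symm
      | succ j =>
        have h3 := hy _ hj i (by omega) h2
        have h4 := hx j (by omega) _ hi h1
        omega

/-- Two disjoint link paths, each extended by a final edge; they merge if the final vertices agree. -/
theorem linkEdges_paths {b c d d' : V} {u w : ℕ → V} {n : ℕ}
    (hu : ∀ i < n + 1, ∀ j < n + 1, u i = u j → i = j)
    (hw : ∀ i < n + 1, ∀ j < n + 1, w i = w j → i = j)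
    (huw : ∀ i < n + 1, ∀ j < n + 1, u i ≠ w j)
    (hv : ∀ v ∈ ({b, c, d, d'} : Set V), ∀ i < n + 1, u i ≠ v ∧ w i ≠ v)
    (hbc : b ≠ c) (hbd : b ≠ d) (hbd' : b ≠ d') (hcd : c ≠ d) (hcd' : c ≠ d') :
    (d = d' → EdgePath (insert s(u n, d) (linkEdges b u u (n + 1)) ∪
      insert s(w n, d') (linkEdges c w w (n + 1))) c b) ∧
    (d ≠ d' → EdgePath (insert s(u n, d) (linkEdges b u u (n + 1))) b d ∧
      EdgePath (insert s(w n, d') (linkEdges c w w (n + 1))) c d' ∧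
      Disjoint (VsetE (insert s(u n, d) (linkEdges b u u (n + 1))))
        (VsetE (insert s(w n, d') (linkEdges c w w (n + 1))))) := by
  simp only [Set.mem_insert_iff, Set.mem_singleton_iff, forall_eq_or_imp, forall_eq] at hv
  obtain ⟨hb, hc, hd, hd'⟩ := hv
  have h1 := edgePath_linkEdges hu (fun i hi => (hb i hi).1) (Nat.lt_succ_self n)
  have h2 := edgePath_linkEdges hw (fun i hi => (hc i hi).2) (Nat.lt_succ_self n)
  have h1d : d ∉ VsetE (linkEdges b u u (n + 1)) := fun h => by
    rcases mem_VsetE_linkEdges h with h | ⟨i, hi, h⟩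
    · exact hbd h.symm
    · exact (hd i hi).1 (by tauto)
  have h2d : d' ∉ VsetE (linkEdges c w w (n + 1)) := fun h => by
    rcases mem_VsetE_linkEdges h with h | ⟨i, hi, h⟩
    · exact hcd' h.symm
    · exact (hd' i hi).2 (by tauto)
  have h12 : ∀ v ∈ VsetE (linkEdges b u u (n + 1)),
      v ∉ VsetE (insert s(w n, d') (linkEdges c w w (n + 1))) := by
    intro v hv hv'
    rcases mem_VsetE_linkEdges hv with h | ⟨i, hi, h⟩ <;>
      rcases (mem_VsetE_insert_linkEdges (y := w)).1 hv' with h' | h' | ⟨j, hj, h'⟩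
    · exact hbd' (h.symm.trans h')
    · exact hbc (h.symm.trans h')
    · exact (hb j hj).2 (by rw [← h]; tauto)
    · exact (hd' i hi).1 (by rw [← h']; tauto)
    · exact (hc i hi).1 (by rw [← h']; tauto)
    · exact huw i hi j hj (by rw [or_self] at h h'; rw [← h, h'])
  constructor
  · rintro rfl
    have := (h2.snoc h2d).append h1.symm (Set.disjoint_right.2 h12)
    convert this using 1
    rw [Sym2.eq_swap (a := d)]
    ext e
    simp only [Finset.mem_union, Finset.mem_insert]
    tauto
  · intro hdd
    refine ⟨h1.snoc h1d, h2.snoc h2d, Set.disjoint_left.2 fun v hv hv' => ?_⟩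
    rcases (mem_VsetE_insert_linkEdges (y := u)).1 hv with h | h
    · rcases (mem_VsetE_insert_linkEdges (y := w)).1 hv' with h' | h' | ⟨j, hj, h'⟩
      · exact hdd (h.symm.trans h')
      · exact hcd (h'.symm.trans h)
      · exact (hd j hj).2 (by rw [← h]; tauto)
    · rw [mem_VsetE_insert] at hv
      rcases hv with rfl | rfl | hv
      · exact h12 _ h1.right_mem hv'
      · rcases h with h | ⟨i, hi, h⟩
        · exact hbd h.symm
        · exact (hd i hi).1 (by tauto)
      · exact h12 v hv hv'

theorem stmt9 (S1 S2 P1 P2 : Finset (Sym2 V)) (k : ℕ)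
    (Q : ℕ → Finset (Sym2 V)) (x y : ℕ → V) (v0 v1 v3 v4 : V)
    (hS1 : IsPathCoverE S1) (hS2 : IsPathCoverE S2)
    (hk : 1 ≤ k)
    (hQ : ∀ i < k, IsPathE (Q i) (x i) (y i))
    (hQdisj : ∀ i < k, ∀ j < k, i ≠ j → Disjoint (VsetE (Q i)) (VsetE (Q j)))
    (hP1 : IsPathE P1 v4 v3) (hP2 : IsPathE P2 v1 v0)
    (hVP : VsetE P1 = VsetE P2)
    (hPS1 : ∀ R : Finset (Sym2 V), MaxPathE S1 R ↔ (R = P1 ∨ ∃ i < k, R = Q i))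
    (hPS2 : ∀ R : Finset (Sym2 V), MaxPathE S2 R ↔ (R = P2 ∨ ∃ i < k, R = Q i))
    (hv3 : v3 ≠ v0 ∧ v3 ≠ v1) (hv1 : v1 ≠ v3 ∧ v1 ≠ v4) :
    ∃ A1 A2 : Finset (Sym2 V),
      A1 ∩ A2 = ∅ ∧
      IsTourE (S1 ∪ A1) ∧ IsTourE (S2 ∪ A2) ∧
      VsetE A1 = V1E S1 ∧ VsetE A2 = V1E S2 ∧
      s(v3, x 0) ∈ A1 ∧ s(v1, y 0) ∈ A2 ∧
      (v0 = v4 → IsPathE (A1 ∪ A2) v1 v3) ∧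
      (v0 ≠ v4 → Odd k →
        ∃ R1 R2 : Finset (Sym2 V), IsPathE R1 v0 v3 ∧ IsPathE R2 v1 v4 ∧
          Disjoint (VsetE R1) (VsetE R2) ∧ A1 ∪ A2 = R1 ∪ R2) ∧
      (v0 ≠ v4 → Even k →
        ∃ R1 R2 : Finset (Sym2 V), IsPathE R1 v0 v1 ∧ IsPathE R2 v3 v4 ∧
          Disjoint (VsetE R1) (VsetE R2) ∧ A1 ∪ A2 = R1 ∪ R2) := by
  have hP1 := hP1.edgePath
  have hP2 := hP2.edgePath
  have hQ : ∀ i < k, EdgePath (Q i) (x i) (y i) := fun i hi => (hQ i hi).edgePath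
  have hQ' : ∀ i < k, EdgePath (Q i) (y i) (x i) := fun i hi => (hQ i hi).symm
  have hmP1 : MaxPathE S1 P1 := (hPS1 P1).2 (.inl rfl)
  have hmP2 : MaxPathE S2 P2 := (hPS2 P2).2 (.inl rfl)
  have hPQ1 : ∀ i < k, Disjoint (VsetE P1) (VsetE (Q i)) := by
    intro i hi
    refine Set.disjoint_left.2 fun v hv hv' => ?_
    have h1 := hmP1.eq_of_mem ((hPS1 (Q i)).2 (.inr ⟨i, hi, rfl⟩)) hv hv'
    have h2 := hmP2.eq_of_mem ((hPS2 (Q i)).2 (.inr ⟨i, hi, rfl⟩)) (hVP ▸ hv) hv'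
    have hd1 := hP1.degE_eq v3 hP1.right_mem
    have hd2 := hP2.degE_eq v3 (hVP ▸ hP1.right_mem)
    rw [if_pos (.inr rfl), h1, ← h2, hd2, if_neg (not_or.2 ⟨hv3.2, hv3.1⟩)] at hd1
    omega
  have hPQ2 : ∀ i < k, Disjoint (VsetE P2) (VsetE (Q i)) := hVP ▸ hPQ1
  have hsep : ∀ i < k, ∀ j < k, ∀ v, v ∈ VsetE (Q i) → v ∈ VsetE (Q j) → i = j := by
    intro i hi j hj v hv hv'
    by_contra hij
    exact Set.disjoint_left.1 (hQdisj i hi j hj hij) hv hv'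
  have hx : ∀ i < k, ∀ j < k, x i = x j → i = j := fun i hi j hj h =>
    hsep i hi j hj (x i) (hQ i hi).left_mem (h ▸ (hQ j hj).left_mem)
  have hy : ∀ i < k, ∀ j < k, y i = y j → i = j := fun i hi j hj h =>
    hsep i hi j hj (y i) (hQ i hi).right_mem (h ▸ (hQ j hj).right_mem)
  have hxy : ∀ i < k, ∀ j < k, x i ≠ y j := fun i hi j hj h => by
    have := hsep i hi j hj (x i) (hQ i hi).left_mem (h ▸ (hQ j hj).right_mem)
    subst this
    exact (hQ i hi).ne h
  have hP : ∀ v ∈ VsetE P1, ∀ i < k, x i ≠ v ∧ y i ≠ v := by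
    refine fun v hv i hi => ⟨?_, ?_⟩ <;> rintro rfl
    · exact Set.disjoint_left.1 (hPQ1 i hi) hv (hQ i hi).left_mem
    · exact Set.disjoint_left.1 (hPQ1 i hi) hv (hQ i hi).right_mem
  have hV : ∀ v ∈ ({v3, v1, v0, v4} : Set V), ∀ i < k, x i ≠ v ∧ y i ≠ v := by
    rintro v (rfl | rfl | rfl | rfl)
    · exact hP _ hP1.right_mem
    · exact hP _ (hVP ▸ hP2.left_mem)
    · exact hP _ (hVP ▸ hP2.right_mem)
    · exact hP _ hP1.left_mem
  obtain ⟨n, rfl⟩ := Nat.exists_eq_add_of_le' hk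
  have h43 := hP1.ne
  have h10 := hP2.ne
  set u := zigzag x y with hu_def
  set w := zigzag y x with hw_def
  have hzz : ∀ i, (u i = x i ∧ w i = y i) ∨ (u i = y i ∧ w i = x i) := by
    intro i
    simp only [hu_def, hw_def, zigzag]
    split_ifs <;> simp
  have hu : ∀ i < n + 1, ∀ j < n + 1, u i = u j → i = j := by
    intro i hi j hj h
    rcases hzz i with h1 | h1 <;> rcases hzz j with h2 | h2 <;> rw [h1.1, h2.1] at h
    · exact hx i hi j hj h
    · exact absurd h (hxy i hi j hj)
    · exact absurd h.symm (hxy j hj i hi)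
    · exact hy i hi j hj h
  have hw : ∀ i < n + 1, ∀ j < n + 1, w i = w j → i = j := by
    intro i hi j hj h
    rcases hzz i with h1 | h1 <;> rcases hzz j with h2 | h2 <;> rw [h1.2, h2.2] at h
    · exact hy i hi j hj h
    · exact absurd h.symm (hxy j hj i hi)
    · exact absurd h (hxy i hi j hj)
    · exact hx i hi j hj h
  have huw : ∀ i < n + 1, ∀ j < n + 1, u i ≠ w j := by
    intro i hi j hj h
    by_cases hij : i = j
    · subst hij
      rcases hzz i with h1 | h1 <;> rw [h1.1, h1.2] at h
      · exact hxy i hi i hi h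
      · exact hxy i hi i hi h.symm
    · simp only [hu_def, hw_def, zigzag] at h
      split_ifs at h
      · exact hxy i hi j hj h
      · exact hij (hx i hi j hj h)
      · exact hij (hy i hi j hj h)
      · exact hxy j hj i hi h.symm
  have hVz : ∀ v ∈ ({v3, v1, v0, v4} : Set V), ∀ i < n + 1, u i ≠ v ∧ w i ≠ v := by
    intro v hv i hi
    rcases hzz i with h1 | h1 <;> rw [h1.1, h1.2]
    exacts [hV v hv i hi, (hV v hv i hi).symm]
  have hunion : insert s(prepend v3 y (n + 1), v4) (linkEdges v3 x y (n + 1)) ∪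
      insert s(prepend v1 x (n + 1), v0) (linkEdges v1 y x (n + 1)) =
      insert s(y n, v4) (insert s(x n, v0)
        (linkEdges v3 u u (n + 1) ∪ linkEdges v1 w w (n + 1))) := by
    rw [← linkEdges_union_linkEdges, Finset.insert_union, Finset.union_insert]
    rfl
  have hOdd : Odd (n + 1) → insert s(prepend v3 y (n + 1), v4) (linkEdges v3 x y (n + 1)) ∪
      insert s(prepend v1 x (n + 1), v0) (linkEdges v1 y x (n + 1)) =
      insert s(u n, v0) (linkEdges v3 u u (n + 1)) ∪
        insert s(w n, v4) (linkEdges v1 w w (n + 1)) := by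
    intro hk
    have hn : Even n := by
      rw [← Nat.not_even_iff_odd, Nat.even_add_one, not_not] at hk
      exact hk
    rw [hunion, Finset.insert_union, Finset.union_insert, Finset.insert_comm]
    simp [hu_def, hw_def, zigzag, hn]
  have hEven : Even (n + 1) → insert s(prepend v3 y (n + 1), v4) (linkEdges v3 x y (n + 1)) ∪
      insert s(prepend v1 x (n + 1), v0) (linkEdges v1 y x (n + 1)) =
      insert s(u n, v4) (linkEdges v3 u u (n + 1)) ∪
        insert s(w n, v0) (linkEdges v1 w w (n + 1)) := by
    intro hk
    rw [Nat.even_add_one] at hk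
    rw [hunion, Finset.insert_union, Finset.union_insert]
    simp [hu_def, hw_def, zigzag, hk]
  have hodd := linkEdges_paths (b := v3) (c := v1) (d := v0) (d' := v4) hu hw huw
    hVz hv3.2 hv3.1 h43.symm h10 hv1.2
  have heven := linkEdges_paths (b := v3) (c := v1) (d := v4) (d' := v0) hu hw huw
    (Set.pair_comm v0 v4 ▸ hVz) hv3.2 h43.symm hv3.1 hv1.2 h10
  refine ⟨insert s(prepend v3 y (n + 1), v4) (linkEdges v3 x y (n + 1)),
    insert s(prepend v1 x (n + 1), v0) (linkEdges v1 y x (n + 1)),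
    disjoint_linkEdges hx hy hxy hV hk hv3.1 hv1.2,
    isTourE_union_linkEdges hS1.2.1 hk hP1 hQ hQdisj hPQ1 (mem_iff_of_maxPathE_iff hS1 hPS1),
    isTourE_union_linkEdges hS2.2.1 hk hP2.symm hQ' hQdisj hPQ2
      (mem_iff_of_maxPathE_iff hS2 hPS2), ?_, ?_, ?_, ?_, ?_, ?_, ?_⟩
  · ext v
    rw [mem_VsetE_insert_linkEdges, mem_V1E_iff hS1 hP1 hQ hPS1]
  · ext v
    rw [mem_VsetE_insert_linkEdges, mem_V1E_iff hS2 hP2.symm hQ' hPS2]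
  · exact Finset.mem_insert_of_mem (Finset.mem_image.2 ⟨0, by simp, rfl⟩)
  · exact Finset.mem_insert_of_mem (Finset.mem_image.2 ⟨0, by simp, rfl⟩)
  · intro h
    rcases Nat.even_or_odd (n + 1) with hp | hp
    · rw [hEven hp]
      exact (heven.1 h.symm).isPathE
    · rw [hOdd hp]
      exact (hodd.1 h).isPathE
  · intro h hp
    obtain ⟨h1, h2, h3⟩ := hodd.2 h
    exact ⟨_, _, h1.symm.isPathE, h2.isPathE, h3, hOdd hp⟩
  · intro h hp
    obtain ⟨h1, h2, h3⟩ := heven.2 (Ne.symm h)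
    exact ⟨_, _, h2.symm.isPathE, h1.isPathE, h3.symm, by rw [hEven hp, Finset.union_comm]⟩
end
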